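/- arXiv:2310.12468 — 2 statements merged into one kernel-verified Lean document; each statement's English description precedes it below -/
import Mathlib

section
/- (Lévy) For Lebesgue-almost every β ∈ (0,1), the limit lim_{n→∞} (1/n) log q_n(β) exists and equals π²/(12 log 2); equivalently, the Lyapunov exponent λ(β) = 2 lim_{n→∞} (1/n) log q_n(β) equals π²/(6 log 2) for almost all β. -/
open Filter MeasureTheory

/-- The Gauss map `T 0 = 0`, `T x = 1/x - ⌊1/x⌋` for `x ≠ 0`. -/
noncomputable def gaussMap (x : ℝ) : ℝ :=
  if x = 0 then 0 else 1 / x - (⌊1 / x⌋ : ℝ)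

/-- The `n`-th continued fraction digit of `β` (for `n ≥ 1`): `a_n(β) = ⌊1/(T^{n-1} β)⌋`. -/
noncomputable def digit (β : ℝ) (n : ℕ) : ℤ :=
  ⌊1 / (gaussMap^[n - 1] β)⌋

/-- Convergent denominators (`qq a (k+1) = q_k`, `q_{-1}=0`, `q_0=1`,
`q_k = a_k q_{k-1} + q_{k-2}`). -/
def qq (a : ℕ → ℤ) : ℕ → ℤ
  | 0 => 0
  | 1 => 1
  | k + 2 => a (k + 1) * qq a (k + 1) + qq a k

/-- `qDen β (n+1) = q_n(β)`, the denominator of the `n`-th convergent of `β`. -/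
noncomputable def qDen (β : ℝ) : ℕ → ℤ := qq (digit β)

section ErgodicAverage

variable {α : Type*} [MeasurableSpace α] {μ : Measure α} {T : α → α} {f : α → ℝ}

theorem memLp_birkhoffSum (hT : MeasurePreserving T μ μ) (hf : MemLp f 2 μ) (n : ℕ) :
    MemLp (birkhoffSum T f n) 2 μ :=
  memLp_finsetSum' (f := fun k x => f (T^[k] x)) (Finset.range n)
    (fun k _ => hf.comp_measurePreserving (hT.iterate k)) |>.ae_eq
    (by filter_upwards with x; simp [birkhoffSum])

theorem integral_birkhoffSum (hT : MeasurePreserving T μ μ) (hf : Integrable f μ) (n : ℕ) :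
    ∫ x, birkhoffSum T f n x ∂μ = n * ∫ x, f x ∂μ := by
  have hi : ∀ k, Integrable (fun x => f (T^[k] x)) μ := fun k =>
    (hT.iterate k).integrable_comp_of_integrable hf
  have he : ∀ k, ∫ x, f (T^[k] x) ∂μ = ∫ x, f x ∂μ := fun k => by
    have h := (hT.iterate k).map_eq
    conv_rhs => rw [← h]
    rw [integral_map (hT.iterate k).measurable.aemeasurable]
    rw [h]; exact hf.1
  simp only [birkhoffSum]
  rw [integral_finsetSum _ fun k _ => hi k]
  simp [he]

theorem integral_sq_birkhoffSum_le (hT : MeasurePreserving T μ μ) (hf : MemLp f 2 μ) {c D : ℝ}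
    (hD : 0 ≤ D) (hcor : ∀ m : ℕ, ∫ x, f x * f (T^[m] x) ∂μ ≤ c ^ 2 + D * (1 / 2) ^ m) (n : ℕ) :
    ∫ x, birkhoffSum T f n x ^ 2 ∂μ ≤ n ^ 2 * c ^ 2 + 3 * D * n := by
  induction n with
  | zero => simp
  | succ n ih =>
    have hS := memLp_birkhoffSum hT hf n
    have hST := hS.comp_measurePreserving hT
    have hfi : ∀ m, Integrable (fun x => f x * f (T^[m] x)) μ := fun m =>
      hf.integrable_mul (hf.comp_measurePreserving (hT.iterate m))
    have e : ∀ x, birkhoffSum T f (n + 1) x ^ 2 =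
        f x * f (T^[0] x) + 2 * (∑ k ∈ Finset.range n, f x * f (T^[k + 1] x)) +
          birkhoffSum T f n (T x) ^ 2 := fun x => by
      rw [birkhoffSum_succ', ← Finset.mul_sum]
      have : birkhoffSum T f n (T x) = ∑ k ∈ Finset.range n, f (T^[k + 1] x) := by
        simp [birkhoffSum]
      rw [← this]; simp; ring
    have hsq : ∫ x, birkhoffSum T f n (T x) ^ 2 ∂μ = ∫ x, birkhoffSum T f n x ^ 2 ∂μ := by
      have h := hT.map_eq
      conv_rhs => rw [← h]
      rw [integral_map hT.measurable.aemeasurable]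
      rw [h]; exact hS.1.pow 2
    have hsum : ∫ x, ∑ k ∈ Finset.range n, f x * f (T^[k + 1] x) ∂μ ≤ n * c ^ 2 + D := by
      rw [integral_finsetSum _ fun k _ => hfi (k + 1)]
      calc _ ≤ ∑ k ∈ Finset.range n, (c ^ 2 + D * (1 / 2) ^ (k + 1)) :=
            Finset.sum_le_sum fun k _ => hcor (k + 1)
        _ = n * c ^ 2 + D * (1 - (1 / 2) ^ n) := by
            clear * -
            induction n with
            | zero => simp
            | succ n ih => rw [Finset.sum_range_succ, ih]; push_cast; ring
        _ ≤ _ := by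
            have : D * (1 / 2 : ℝ) ^ n ≥ 0 := by positivity
            linarith
    have h0 := hcor 0
    simp only [e]
    rw [integral_add, integral_add, integral_const_mul, hsq]
    · push_cast
      simp only [pow_zero, mul_one] at h0
      nlinarith
    · exact hfi 0
    · exact (integrable_finsetSum _ fun k _ => hfi (k + 1)).const_mul 2
    · exact (hfi 0).add ((integrable_finsetSum _ fun k _ => hfi (k + 1)).const_mul 2)
    · exact hST.integrable_sq

/-- Pointwise convergence of the ergodic averages of a nonnegative square integrable observable
with exponentially decaying correlations. -/
theorem ae_tendsto_birkhoffSum_div [IsProbabilityMeasure μ] (hT : MeasurePreserving T μ μ)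
    (hf0 : ∀ x, 0 ≤ f x) (hf : MemLp f 2 μ) {D : ℝ} (hD : 0 ≤ D)
    (hcor : ∀ m : ℕ, ∫ x, f x * f (T^[m] x) ∂μ ≤ (∫ x, f x ∂μ) ^ 2 + D * (1 / 2) ^ m) :
    ∀ᵐ x ∂μ, Tendsto (fun n : ℕ => birkhoffSum T f n x / n) atTop (nhds (∫ x, f x ∂μ)) := by
  set c := ∫ x, f x ∂μ with hc
  have hfi : Integrable f μ := hf.integrable (by norm_num)
  have hdev : ∀ n : ℕ, MemLp (fun x => birkhoffSum T f n x - n * c) 2 μ := fun n =>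
    (memLp_birkhoffSum hT hf n).sub (memLp_const _)
  have hvar : ∀ n : ℕ, ∫ x, (birkhoffSum T f n x - n * c) ^ 2 ∂μ ≤ 3 * D * n := fun n => by
    have hS := memLp_birkhoffSum hT hf n
    have e : ∀ x, (birkhoffSum T f n x - n * c) ^ 2 =
        birkhoffSum T f n x ^ 2 - 2 * n * c * birkhoffSum T f n x + (n * c) ^ 2 := fun x => by ring
    simp only [e]
    rw [integral_add, integral_sub, integral_const_mul, integral_birkhoffSum hT hfi]
    · have := integral_sq_birkhoffSum_le hT hf hD hcor n
      simp only [integral_const, probReal_univ, one_smul]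
      nlinarith
    · exact hS.integrable_sq
    · exact (hS.integrable (by norm_num)).const_mul _
    · exact hS.integrable_sq.sub ((hS.integrable (by norm_num)).const_mul _)
    · exact integrable_const _
  let F : ℕ → α → ENNReal := fun m x =>
    ENNReal.ofReal (((birkhoffSum T f ((m + 1) ^ 2) x - ((m + 1) ^ 2 : ℕ) * c) /
      ((m + 1) ^ 2 : ℕ)) ^ 2)
  have hFm : ∀ m, AEMeasurable (F m) μ := fun m =>
    (((hdev ((m + 1) ^ 2)).1.aemeasurable.div_const _).pow_const 2).ennreal_ofReal
  have hFle : ∀ m, ∫⁻ x, F m x ∂μ ≤ ENNReal.ofReal (3 * D * (1 / ((m : ℝ) + 1) ^ 2)) := fun m => by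
    simp only [F, div_pow]
    rw [← ofReal_integral_eq_lintegral_ofReal ((hdev ((m + 1) ^ 2)).integrable_sq.div_const _)
      (by filter_upwards with x; positivity)]
    apply ENNReal.ofReal_le_ofReal
    rw [integral_div, div_le_iff₀ (by positivity)]
    refine (hvar _).trans (le_of_eq ?_)
    push_cast
    field_simp
  have hsum : ∫⁻ x, ∑' m, F m x ∂μ ≠ ⊤ := by
    rw [lintegral_tsum hFm]
    refine ne_top_of_le_ne_top ?_ (ENNReal.tsum_le_tsum hFle)
    have hs : Summable fun m : ℕ => 3 * D * (1 / ((m : ℝ) + 1) ^ 2) := by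
      have := (summable_nat_add_iff 1).2 (Real.summable_one_div_nat_pow.2 one_lt_two)
      simp only [Nat.cast_add, Nat.cast_one] at this
      exact this.mul_left _
    rw [← ENNReal.ofReal_tsum_of_nonneg (fun m => by positivity) hs]
    exact ENNReal.ofReal_ne_top
  have hae := ae_lt_top' (AEMeasurable.tsum hFm) hsum
  filter_upwards [hae] with x hx
  have h1 := ENNReal.tendsto_atTop_zero_of_tsum_ne_top hx.ne
  have h2 : Tendsto (fun m : ℕ => ((birkhoffSum T f ((m + 1) ^ 2) x - ((m + 1) ^ 2 : ℕ) * c) /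
      ((m + 1) ^ 2 : ℕ)) ^ 2) atTop (nhds 0) := by
    have := (ENNReal.tendsto_toReal ENNReal.zero_ne_top).comp h1
    refine this.congr fun m => ?_
    simp only [F, Function.comp]
    rw [ENNReal.toReal_ofReal (by positivity)]
  have h3 : Tendsto (fun m : ℕ => (birkhoffSum T f ((m + 1) ^ 2) x - ((m + 1) ^ 2 : ℕ) * c) /
      ((m + 1) ^ 2 : ℕ)) atTop (nhds 0) := by
    have h := h2.sqrt
    simp only [Real.sqrt_sq_eq_abs, Real.sqrt_zero] at h
    exact (tendsto_zero_iff_abs_tendsto_zero _).2 h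
  have h4 : Tendsto (fun m : ℕ => birkhoffSum T f ((m + 1) ^ 2) x / ((m + 1) ^ 2 : ℕ)) atTop
      (nhds c) := by
    have := h3.add_const c
    rw [zero_add] at this
    refine this.congr fun m => ?_
    have : (((m + 1) ^ 2 : ℕ) : ℝ) ≠ 0 := by positivity
    field_simp
    ring
  have hsqt : Tendsto (fun m : ℕ => (m + 1) ^ 2) atTop atTop :=
    (tendsto_pow_atTop two_ne_zero).comp (tendsto_add_atTop_nat 1)
  refine tendsto_div_of_monotone_of_exists_subseq_tendsto_div _ _ ?_ fun a ha =>
    ⟨fun m => (m + 1) ^ 2, ?_, hsqt, h4⟩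
  · refine monotone_nat_of_le_succ fun n => ?_
    rw [birkhoffSum_succ]
    linarith [hf0 (T^[n] x)]
  · have hr : Tendsto (fun m : ℕ => (1 + 1 / ((m : ℝ) + 1)) ^ 2) atTop (nhds 1) := by
      have := (tendsto_one_div_add_atTop_nhds_zero_nat (𝕜 := ℝ)).const_add 1 |>.pow 2
      simpa using this
    filter_upwards [hr.eventually_le_const ha] with m hm
    have hp : (0 : ℝ) < (m : ℝ) + 1 := by positivity
    calc (((m + 1 + 1) ^ 2 : ℕ) : ℝ) = (1 + 1 / ((m : ℝ) + 1)) ^ 2 * (m + 1) ^ 2 := by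
          push_cast; field_simp
      _ ≤ a * (m + 1) ^ 2 := by gcongr
      _ = _ := by push_cast; rfl

end ErgodicAverage

section Transfer

open Set

/-- The weight of the `(k+1)`-st inverse branch of the Gauss map, relative to the Gauss measure. -/
noncomputable def gaussWeight (k : ℕ) (x : ℝ) : ℝ := (1 + x) / ((k + 1 + x) * (k + 2 + x))

/-- The transfer operator of the Gauss map relative to the Gauss measure. -/
noncomputable def gaussTransfer (g : ℝ → ℝ) (x : ℝ) : ℝ :=
  ∑' k : ℕ, gaussWeight k x * g (1 / (k + 1 + x))

theorem gaussWeight_nonneg (k : ℕ) {x : ℝ} (hx : 0 ≤ x) : 0 ≤ gaussWeight k x := by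
  unfold gaussWeight; positivity

theorem branch_mem_Ioc (k : ℕ) {x : ℝ} (hx : 0 ≤ x) : 1 / ((k : ℝ) + 1 + x) ∈ Ioc (0 : ℝ) 1 := by
  have : (0 : ℝ) ≤ k := k.cast_nonneg
  refine ⟨by positivity, ?_⟩
  rw [div_le_one (by positivity)]; linarith

theorem branch_mem_Icc (k : ℕ) {x : ℝ} (hx : 0 ≤ x) : 1 / ((k : ℝ) + 1 + x) ∈ Icc (0 : ℝ) 1 :=
  Ioc_subset_Icc_self (branch_mem_Ioc k hx)

theorem hasSum_gaussWeight {x : ℝ} (hx : 0 ≤ x) : HasSum (fun k => gaussWeight k x) 1 := by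
  rw [hasSum_iff_tendsto_nat_of_nonneg fun k => gaussWeight_nonneg k hx]
  have e : ∀ n : ℕ, ∑ k ∈ Finset.range n, gaussWeight k x = 1 - (1 + x) / (n + (1 + x)) := by
    intro n
    induction n with
    | zero => simp; rw [div_self (by positivity), sub_self]
    | succ n ih =>
      rw [Finset.sum_range_succ, ih, gaussWeight]
      push_cast
      field_simp
      ring
  simp only [e]
  have : Tendsto (fun n : ℕ => (1 + x) / ((n : ℝ) + (1 + x))) atTop (nhds 0) :=
    (tendsto_atTop_add_const_right _ _ tendsto_natCast_atTop_atTop).const_div_atTop _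
  simpa using this.const_sub 1

theorem gaussTransfer_neg (g : ℝ → ℝ) (x : ℝ) :
    gaussTransfer (fun y => -g y) x = -gaussTransfer g x := by
  simp only [gaussTransfer, mul_neg, tsum_neg]

theorem measurable_gaussTransfer {g : ℝ → ℝ} (hg : Measurable g) :
    Measurable (gaussTransfer g) := by
  unfold gaussTransfer
  refine Measurable.tsum fun k => ?_
  unfold gaussWeight
  fun_prop

theorem gaussTransfer_nonneg {g : ℝ → ℝ} (hg : ∀ x ∈ Ioc (0 : ℝ) 1, 0 ≤ g x) {x : ℝ} (hx : 0 ≤ x) :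
    0 ≤ gaussTransfer g x :=
  tsum_nonneg fun k => mul_nonneg (gaussWeight_nonneg k hx) (hg _ (branch_mem_Ioc k hx))

theorem gaussWeight_sub (k : ℕ) {x y : ℝ} (hx : 0 ≤ x) (hy : 0 ≤ y) :
    gaussWeight k y - gaussWeight k x =
      (y - x) * (((k : ℝ) + 1) * k - (1 + x) * (1 + y)) /
        ((k + 1 + x) * (k + 2 + x) * ((k + 1 + y) * (k + 2 + y))) := by
  unfold gaussWeight
  field_simp
  ring

theorem gaussTransfer_le_of_antitoneOn {h : ℝ → ℝ} (hh : AntitoneOn h (Ioc 0 1))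
    (hs : ∀ x ∈ Icc (0 : ℝ) 1, ∀ y ∈ Icc (0 : ℝ) 1,
      Summable fun k : ℕ => gaussWeight k x * h (1 / (k + 1 + y)))
    {x y : ℝ} (hx : x ∈ Icc (0 : ℝ) 1) (hy : y ∈ Icc (0 : ℝ) 1) (hxy : x ≤ y) :
    gaussTransfer h x ≤ gaussTransfer h y := by
  set η : ℕ → ℝ := fun k => h (1 / (k + 1 + y)) with hη
  have hηm : Monotone η := by
    intro a b hab
    refine hh (branch_mem_Ioc b hy.1) (branch_mem_Ioc a hy.1) ?_
    have := hy.1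
    gcongr
  have h1 : gaussTransfer h x ≤ ∑' k, gaussWeight k x * η k := by
    refine (hs x hx x hx).tsum_le_tsum (fun k => ?_) (hs x hx y hy)
    refine mul_le_mul_of_nonneg_left ?_ (gaussWeight_nonneg k hx.1)
    refine hh (branch_mem_Ioc k hy.1) (branch_mem_Ioc k hx.1) ?_
    have := hx.1
    gcongr
  refine h1.trans ?_
  have hwx := (hasSum_gaussWeight hx.1).mul_right (η 1)
  have hwy := (hasSum_gaussWeight hy.1).mul_right (η 1)
  have hd := (((hs y hy y hy).hasSum.sub hwy).sub ((hs x hx y hy).hasSum.sub hwx))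
  have hnn := hd.nonneg fun k => by
    have e : gaussWeight k y * h (1 / (↑k + 1 + y)) - gaussWeight k y * η 1 -
        (gaussWeight k x * h (1 / (↑k + 1 + y)) - gaussWeight k x * η 1) =
        (gaussWeight k y - gaussWeight k x) * (η k - η 1) := by simp only [hη]; ring
    rw [e, gaussWeight_sub k hx.1 hy.1]
    have hx0 := hx.1
    have hy0 := hy.1
    have hden : 0 < ((k : ℝ) + 1 + x) * (k + 2 + x) * ((k + 1 + y) * (k + 2 + y)) := by positivity
    rcases k with _ | _ | k
    · refine mul_nonneg_of_nonpos_of_nonpos (div_nonpos_of_nonpos_of_nonneg ?_ hden.le)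
        (sub_nonpos.2 (hηm (by norm_num)))
      refine mul_nonpos_of_nonneg_of_nonpos (by linarith) ?_
      push_cast
      nlinarith
    · simp
    · refine mul_nonneg (div_nonneg (mul_nonneg (by linarith) ?_) hden.le)
        (sub_nonneg.2 (hηm (by omega)))
      have hk : (0 : ℝ) ≤ k := k.cast_nonneg
      push_cast
      nlinarith [hx.2, hy.2, mul_le_mul hx.2 hy.2 hy0 zero_le_one]
  simp only [gaussTransfer]
  linarith

theorem abs_le_of_monotoneOn {g : ℝ → ℝ} (hg : MonotoneOn g (Icc 0 1)) {x : ℝ}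
    (hx : x ∈ Icc (0 : ℝ) 1) : |g x| ≤ |g 0| + |g 1| := by
  have h0 := hg (left_mem_Icc.2 zero_le_one) hx hx.1
  have h1 := hg hx (right_mem_Icc.2 zero_le_one) hx.2
  rw [abs_le]
  constructor <;> linarith [abs_nonneg (g 0), abs_nonneg (g 1), neg_abs_le (g 0), le_abs_self (g 1)]

theorem summable_gaussWeight_mul {g : ℝ → ℝ} {B : ℝ} (hg : ∀ x ∈ Icc (0 : ℝ) 1, |g x| ≤ B)
    {x y : ℝ} (hx : 0 ≤ x) (hy : 0 ≤ y) :
    Summable fun k : ℕ => gaussWeight k x * g (1 / (k + 1 + y)) := by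
  refine Summable.of_norm_bounded ((hasSum_gaussWeight hx).summable.mul_right B) fun k => ?_
  rw [norm_mul, Real.norm_of_nonneg (gaussWeight_nonneg k hx), Real.norm_eq_abs]
  exact mul_le_mul_of_nonneg_left (hg _ (branch_mem_Icc k hy)) (gaussWeight_nonneg k hx)

theorem gaussTransfer_antitoneOn {g : ℝ → ℝ} (hg : MonotoneOn g (Icc 0 1)) :
    AntitoneOn (gaussTransfer g) (Icc 0 1) := by
  intro x hx y hy hxy
  have := gaussTransfer_le_of_antitoneOn (h := fun y => -g y)
    (hg.neg.mono Ioc_subset_Icc_self)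
    (fun x hx y hy => by
      simpa using (summable_gaussWeight_mul (fun z hz => abs_le_of_monotoneOn hg hz) hx.1 hy.1).neg)
    hx hy hxy
  simp only [gaussTransfer_neg] at this
  linarith

theorem gaussTransfer_monotoneOn {g : ℝ → ℝ} (hg : AntitoneOn g (Icc 0 1)) :
    MonotoneOn (gaussTransfer g) (Icc 0 1) := by
  have h := gaussTransfer_antitoneOn (g := fun y => -g y) hg.neg
  intro x hx y hy hxy
  have := h hx hy hxy
  simp only [gaussTransfer_neg] at this
  linarith

/-- The transfer operator halves the oscillation of monotone functions. -/
theorem gaussTransfer_zero_sub_one_le {g : ℝ → ℝ} (hg : MonotoneOn g (Icc 0 1)) :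
    gaussTransfer g 0 - gaussTransfer g 1 ≤ (g 1 - g 0) / 2 := by
  have hs : ∀ {x : ℝ}, 0 ≤ x → Summable fun k : ℕ => gaussWeight k x * g (1 / (k + 1 + x)) :=
    fun hx => summable_gaussWeight_mul (fun z hz => abs_le_of_monotoneOn hg hz) hx hx
  have h0 := (hs le_rfl).hasSum
  rw [← hasSum_nat_add_iff' 1] at h0
  have h1 := (hs zero_le_one).hasSum
  have hw := (hasSum_gaussWeight zero_le_one).mul_right (g 0 / 2)
  have hd := (h1.sub h0).sub hw
  have := hd.nonneg fun k => by
    have e1 : gaussWeight (k + 1) 0 = gaussWeight k 1 / 2 := by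
      unfold gaussWeight
      push_cast
      field_simp
      ring
    have e2 : (1 : ℝ) / (((k + 1 : ℕ) : ℝ) + 1 + 0) = 1 / (k + 1 + 1) := by push_cast; simp
    rw [e1, e2]
    have hle := hg (left_mem_Icc.2 zero_le_one) (branch_mem_Icc k zero_le_one)
      (branch_mem_Icc k zero_le_one).1
    have hw0 := gaussWeight_nonneg k zero_le_one
    nlinarith
  simp only [gaussTransfer]
  have e0 : gaussWeight 0 0 = 1 / 2 := by norm_num [gaussWeight]
  simp [e0] at this
  simp only [add_zero, one_div] at this ⊢
  linarith

theorem gaussTransfer_iterate {g : ℝ → ℝ} (hg : MonotoneOn g (Icc 0 1)) (n : ℕ) :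
    (MonotoneOn (gaussTransfer^[n] g) (Icc 0 1) ∨ AntitoneOn (gaussTransfer^[n] g) (Icc 0 1)) ∧
      |gaussTransfer^[n] g 1 - gaussTransfer^[n] g 0| ≤ (g 1 - g 0) * (1 / 2) ^ n := by
  have l0 : (0 : ℝ) ∈ Icc (0 : ℝ) 1 := left_mem_Icc.2 zero_le_one
  have l1 : (1 : ℝ) ∈ Icc (0 : ℝ) 1 := right_mem_Icc.2 zero_le_one
  induction n with
  | zero =>
    refine ⟨Or.inl hg, ?_⟩
    rw [Function.iterate_zero_apply, abs_of_nonneg (sub_nonneg.2 (hg l0 l1 zero_le_one)), pow_zero,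
      mul_one]
  | succ n ih =>
    rw [Function.iterate_succ_apply']
    obtain ⟨hm | hm, ho⟩ := ih
    · have ha := gaussTransfer_antitoneOn hm
      refine ⟨Or.inr ha, ?_⟩
      have := gaussTransfer_zero_sub_one_le hm
      rw [abs_of_nonpos (sub_nonpos.2 (ha l0 l1 zero_le_one)), pow_succ]
      linarith [le_abs_self (gaussTransfer^[n] g 1 - gaussTransfer^[n] g 0)]
    · have ha := gaussTransfer_monotoneOn hm
      refine ⟨Or.inl ha, ?_⟩
      have := gaussTransfer_zero_sub_one_le hm.neg
      have e := fun x => gaussTransfer_neg (gaussTransfer^[n] g) x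
      change gaussTransfer (fun y => -gaussTransfer^[n] g y) 0 -
        gaussTransfer (fun y => -gaussTransfer^[n] g y) 1 ≤
        (-gaussTransfer^[n] g 1 - -gaussTransfer^[n] g 0) / 2 at this
      rw [e, e] at this
      rw [abs_of_nonneg (sub_nonneg.2 (ha l0 l1 zero_le_one)), pow_succ]
      linarith [neg_abs_le (gaussTransfer^[n] g 1 - gaussTransfer^[n] g 0)]

theorem gaussTransfer_iterate_sub_le {g : ℝ → ℝ} (hg : MonotoneOn g (Icc 0 1)) (n : ℕ) {x y : ℝ}
    (hx : x ∈ Icc (0 : ℝ) 1) (hy : y ∈ Icc (0 : ℝ) 1) :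
    gaussTransfer^[n] g x - gaussTransfer^[n] g y ≤ (g 1 - g 0) * (1 / 2) ^ n := by
  have l0 : (0 : ℝ) ∈ Icc (0 : ℝ) 1 := left_mem_Icc.2 zero_le_one
  have l1 : (1 : ℝ) ∈ Icc (0 : ℝ) 1 := right_mem_Icc.2 zero_le_one
  obtain ⟨hm | hm, ho⟩ := gaussTransfer_iterate hg n <;> rw [abs_le] at ho
  · linarith [hm hx l1 hx.2, hm l0 hy hy.1]
  · linarith [hm l0 hx hx.1, hm hy l1 hy.2]

theorem summable_gaussWeight_mul_log {x y : ℝ} (hx : x ∈ Icc (0 : ℝ) 1) (hy : y ∈ Icc (0 : ℝ) 1) :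
    Summable fun k : ℕ => gaussWeight k x * |Real.log (1 / (k + 1 + y))| := by
  have hs : Summable fun k : ℕ => 8 * (1 / (((k + 1 : ℕ) : ℝ)) ^ (3 / 2 : ℝ)) :=
    ((summable_nat_add_iff 1).2 (Real.summable_one_div_nat_rpow.2 (by norm_num))).mul_left 8
  refine Summable.of_nonneg_of_le
    (fun k => mul_nonneg (gaussWeight_nonneg k hx.1) (abs_nonneg _)) (fun k => ?_) hs
  have hx0 := hx.1
  have hy0 := hy.1
  have hk : (0 : ℝ) ≤ k := k.cast_nonneg
  have hw : gaussWeight k x ≤ 2 / (((k : ℝ) + 1) * (k + 1)) := by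
    unfold gaussWeight
    exact div_le_div₀ (by norm_num) (by linarith [hx.2]) (by positivity)
      (mul_le_mul (by linarith) (by linarith) (by positivity) (by positivity))
  have hl : |Real.log (1 / ((k : ℝ) + 1 + y))| ≤ 4 * ((k : ℝ) + 1) ^ (1 / 2 : ℝ) := by
    rw [one_div, Real.log_inv, abs_neg, abs_of_nonneg (Real.log_nonneg (by linarith))]
    calc Real.log ((k : ℝ) + 1 + y) ≤ ((k : ℝ) + 1 + y) ^ (1 / 2 : ℝ) / (1 / 2) :=
          Real.log_le_rpow_div (by positivity) (by norm_num)
      _ ≤ (4 * ((k : ℝ) + 1)) ^ (1 / 2 : ℝ) / (1 / 2) := by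
          gcongr
          linarith [hy.2]
      _ = 4 * ((k : ℝ) + 1) ^ (1 / 2 : ℝ) := by
          rw [Real.mul_rpow (by norm_num) (by positivity), ← Real.sqrt_eq_rpow 4,
            show (4 : ℝ) = 2 ^ 2 by norm_num, Real.sqrt_sq (by norm_num)]
          ring
  calc _ ≤ 2 / (((k : ℝ) + 1) * (k + 1)) * (4 * ((k : ℝ) + 1) ^ (1 / 2 : ℝ)) :=
        mul_le_mul hw hl (abs_nonneg _) (by positivity)
    _ = 8 * (1 / (((k + 1 : ℕ) : ℝ)) ^ (3 / 2 : ℝ)) := by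
        have e : ((k : ℝ) + 1) * (k + 1) =
            ((k : ℝ) + 1) ^ (1 / 2 : ℝ) * ((k : ℝ) + 1) ^ (3 / 2 : ℝ) := by
          rw [← Real.rpow_add (by positivity)]
          norm_num
          ring
        have : ((k : ℝ) + 1) ^ (1 / 2 : ℝ) ≠ 0 := by positivity
        push_cast
        rw [e]
        field_simp
        norm_num

theorem antitoneOn_abs_log : AntitoneOn (fun x => |Real.log x|) (Ioc 0 1) := by
  intro x hx y hy hxy
  simp only
  rw [abs_of_nonpos (Real.log_nonpos hx.1.le hx.2), abs_of_nonpos (Real.log_nonpos hy.1.le hy.2)]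
  exact neg_le_neg (Real.log_le_log hx.1 hxy)

theorem gaussTransfer_log_monotoneOn :
    MonotoneOn (gaussTransfer fun x => |Real.log x|) (Icc 0 1) := fun _ hx _ hy hxy =>
  gaussTransfer_le_of_antitoneOn antitoneOn_abs_log
    (fun _ hx _ hy => summable_gaussWeight_mul_log hx hy) hx hy hxy

end Transfer

section GaussMeasure

open Set

/-- The Gauss measure on the unit interval. -/
noncomputable def gaussMeasure : Measure ℝ :=
  (volume.restrict (Ioo (0 : ℝ) 1)).withDensity fun x => ENNReal.ofReal (1 / (Real.log 2 * (1 + x)))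

theorem log_two_pos : 0 < Real.log 2 := Real.log_pos one_lt_two

theorem measurable_gaussDensity :
    Measurable fun x : ℝ => ENNReal.ofReal (1 / (Real.log 2 * (1 + x))) := by fun_prop

theorem lintegral_gaussMeasure {F : ℝ → ENNReal} (hF : Measurable F) :
    ∫⁻ x, F x ∂gaussMeasure =
      ∫⁻ x in Ioo (0 : ℝ) 1, ENNReal.ofReal (1 / (Real.log 2 * (1 + x))) * F x := by
  rw [gaussMeasure, lintegral_withDensity_eq_lintegral_mul _ measurable_gaussDensity hF]
  rfl

theorem gaussMeasure_absolutelyContinuous : gaussMeasure ≪ volume.restrict (Ioo (0 : ℝ) 1) :=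
  withDensity_absolutelyContinuous _ _

theorem absolutelyContinuous_gaussMeasure : volume.restrict (Ioo (0 : ℝ) 1) ≪ gaussMeasure := by
  refine withDensity_absolutelyContinuous' measurable_gaussDensity.aemeasurable ?_
  filter_upwards [ae_restrict_mem measurableSet_Ioo] with x hx
  have := hx.1
  have := log_two_pos
  have h : 0 < 1 / (Real.log 2 * (1 + x)) := by positivity
  exact (ENNReal.ofReal_pos.2 h).ne'

theorem ae_gaussMeasure_mem : ∀ᵐ x ∂gaussMeasure, x ∈ Ioo (0 : ℝ) 1 :=
  gaussMeasure_absolutelyContinuous.ae_le (ae_restrict_mem measurableSet_Ioo)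

theorem gaussMap_eq_fract (x : ℝ) : gaussMap x = Int.fract (1 / x) := by
  unfold gaussMap
  split_ifs with h
  · simp [h]
  · rfl

theorem measurable_gaussMap : Measurable gaussMap := by
  have : gaussMap = fun x => Int.fract (1 / x) := funext gaussMap_eq_fract
  rw [this]
  fun_prop

theorem gaussMap_branch (k : ℕ) {x : ℝ} (hx : x ∈ Ico (0 : ℝ) 1) :
    gaussMap (1 / (k + 1 + x)) = x := by
  rw [gaussMap_eq_fract, one_div_one_div, show (k : ℝ) + 1 + x = x + ((k + 1 : ℕ) : ℝ) by
    push_cast; ring, Int.fract_add_natCast, Int.fract_eq_self.2 hx]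

theorem iUnion_branch_image :
    ⋃ k : ℕ, (fun x : ℝ => 1 / ((k : ℝ) + 1 + x)) '' Ico 0 1 = Ioc 0 1 := by
  ext z
  simp only [mem_iUnion, mem_image]
  constructor
  · rintro ⟨k, x, hx, rfl⟩
    exact branch_mem_Ioc k hx.1
  · intro hz
    have h1 : 1 ≤ 1 / z := by rw [le_div_iff₀ hz.1]; linarith [hz.2]
    have hfl : 1 ≤ ⌊1 / z⌋₊ := Nat.le_floor (by simpa using h1)
    refine ⟨⌊1 / z⌋₊ - 1, 1 / z - ⌊1 / z⌋₊, ⟨?_, ?_⟩, ?_⟩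
    · linarith [Nat.floor_le (zero_le_one.trans h1)]
    · linarith [Nat.lt_floor_add_one (1 / z)]
    · push_cast [hfl]
      simp

theorem branch_image_disjoint :
    Pairwise (Function.onFun Disjoint fun k : ℕ =>
      (fun x : ℝ => 1 / ((k : ℝ) + 1 + x)) '' Ico 0 1) := by
  intro k j hkj
  rw [Function.onFun, Set.disjoint_left]
  rintro _ ⟨x, hx, rfl⟩ ⟨y, hy, h⟩
  simp only [one_div, inv_inj] at h
  apply hkj
  have h1 : (k : ℝ) < j + 1 := by linarith [hx.1, hy.2]
  have h2 : (j : ℝ) < k + 1 := by linarith [hy.1, hx.2]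
  have h1' : k < j + 1 := by exact_mod_cast h1
  have h2' : j < k + 1 := by exact_mod_cast h2
  omega

theorem hasDerivAt_branch (k : ℕ) {x : ℝ} (hx : 0 ≤ x) :
    HasDerivAt (fun x : ℝ => 1 / ((k : ℝ) + 1 + x)) (-1 / ((k : ℝ) + 1 + x) ^ 2) x := by
  have h : HasDerivAt (fun x : ℝ => (k : ℝ) + 1 + x) 1 x := (hasDerivAt_id x).const_add _
  simpa only [one_div] using h.fun_inv (by positivity)

theorem branch_injOn (k : ℕ) : InjOn (fun x : ℝ => 1 / ((k : ℝ) + 1 + x)) (Ico 0 1) := by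
  intro x _ y _ h
  simpa using h

theorem lintegral_Ioo_eq_tsum_branch {ψ : ℝ → ENNReal} (hψ : Measurable ψ) :
    ∫⁻ x in Ioo (0 : ℝ) 1, ψ x =
      ∫⁻ x in Ioo (0 : ℝ) 1,
        ∑' k : ℕ, ENNReal.ofReal (1 / ((k : ℝ) + 1 + x) ^ 2) * ψ (1 / (k + 1 + x)) := by
  have hm : ∀ k : ℕ, MeasurableSet ((fun x : ℝ => 1 / ((k : ℝ) + 1 + x)) '' Ico 0 1) := fun k =>
    measurableSet_Ico.image_of_measurable_injOn (by fun_prop) (branch_injOn k)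
  have hu : ∫⁻ x in Ioo (0 : ℝ) 1, ψ x =
      ∫⁻ x in ⋃ k : ℕ, (fun x : ℝ => 1 / ((k : ℝ) + 1 + x)) '' Ico 0 1, ψ x := by
    rw [iUnion_branch_image, restrict_Ioo_eq_restrict_Ioc]
  rw [hu, lintegral_iUnion hm branch_image_disjoint, restrict_Ioo_eq_restrict_Ico, lintegral_tsum]
  · congr 1
    ext k
    rw [lintegral_image_eq_lintegral_abs_deriv_mul measurableSet_Ico
      (fun x hx => (hasDerivAt_branch k hx.1).hasDerivWithinAt) (branch_injOn k)]
    refine setLIntegral_congr_fun measurableSet_Ico fun x _ => ?_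
    rw [abs_div, abs_neg, abs_one, abs_of_nonneg (sq_nonneg _)]
  · intro k
    refine Measurable.aemeasurable ?_
    fun_prop

/-- Duality between the transfer operator and composition with the Gauss map. -/
theorem lintegral_mul_comp_gaussMap {g : ℝ → ℝ} (hg : Measurable g)
    (hg0 : ∀ x ∈ Ioc (0 : ℝ) 1, 0 ≤ g x)
    (hs : ∀ x ∈ Icc (0 : ℝ) 1, Summable fun k : ℕ => gaussWeight k x * g (1 / (k + 1 + x)))
    {H : ℝ → ENNReal} (hH : Measurable H) :
    ∫⁻ x, ENNReal.ofReal (g x) * H (gaussMap x) ∂gaussMeasure =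
      ∫⁻ x, ENNReal.ofReal (gaussTransfer g x) * H x ∂gaussMeasure := by
  have hT := measurable_gaussMap
  have hLg := measurable_gaussTransfer hg
  rw [lintegral_gaussMeasure (by fun_prop), lintegral_gaussMeasure (by fun_prop),
    lintegral_Ioo_eq_tsum_branch (by fun_prop)]
  refine setLIntegral_congr_fun measurableSet_Ioo fun x hx => ?_
  rw [gaussTransfer, ENNReal.ofReal_tsum_of_nonneg
    (fun k => mul_nonneg (gaussWeight_nonneg k hx.1.le) (hg0 _ (branch_mem_Ioc k hx.1.le)))
    (hs x (Ioo_subset_Icc_self hx)), ← ENNReal.tsum_mul_right, ← ENNReal.tsum_mul_left]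
  congr 1
  ext k
  have hl := log_two_pos
  have hx0 := hx.1
  rw [gaussMap_branch k (Ioo_subset_Ico_self hx), ← mul_assoc, ← mul_assoc, ← mul_assoc,
    ← ENNReal.ofReal_mul (by positivity), ← ENNReal.ofReal_mul (by positivity),
    ← ENNReal.ofReal_mul (by positivity)]
  congr 2
  rw [← mul_assoc]
  congr 1
  unfold gaussWeight
  field_simp
  ring

theorem integral_Ioo_one_div_one_add :
    ∫ x in Ioo (0 : ℝ) 1, 1 / (Real.log 2 * (1 + x)) = 1 := by
  rw [← integral_Ioc_eq_integral_Ioo, ← intervalIntegral.integral_of_le zero_le_one]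
  have e : ∀ x : ℝ, 1 / (Real.log 2 * (1 + x)) = (Real.log 2)⁻¹ * (1 + x)⁻¹ := fun x => by
    rw [one_div, mul_inv]
  simp only [e]
  rw [intervalIntegral.integral_const_mul,
    intervalIntegral.integral_comp_add_left (fun x => x⁻¹) (1 : ℝ),
    integral_inv_of_pos (by norm_num) (by norm_num)]
  norm_num [log_two_pos.ne']

instance isProbabilityMeasure_gaussMeasure : IsProbabilityMeasure gaussMeasure := by
  constructor
  have hl := log_two_pos
  rw [← lintegral_one, lintegral_gaussMeasure measurable_const]
  simp only [mul_one]
  have hint : Integrable (fun x : ℝ => 1 / (Real.log 2 * (1 + x)))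
      (volume.restrict (Ioo (0 : ℝ) 1)) := by
    by_contra h
    have := integral_undef h
    rw [integral_Ioo_one_div_one_add] at this
    exact one_ne_zero this
  rw [← ofReal_integral_eq_lintegral_ofReal hint, integral_Ioo_one_div_one_add, ENNReal.ofReal_one]
  filter_upwards [ae_restrict_mem measurableSet_Ioo] with x hx
  have := hx.1
  simp only [Pi.zero_apply]
  positivity

theorem measurePreserving_gaussMap : MeasurePreserving gaussMap gaussMeasure gaussMeasure := by
  refine ⟨measurable_gaussMap, ?_⟩
  ext s hs
  have h := lintegral_mul_comp_gaussMap (g := fun _ => 1) measurable_const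
    (fun _ _ => zero_le_one)
    (fun x hx => by simpa using (hasSum_gaussWeight hx.1).summable)
    (H := s.indicator 1) (measurable_one.indicator hs)
  rw [Measure.map_apply measurable_gaussMap hs, ← lintegral_indicator_one hs,
    ← lintegral_indicator_one (measurable_gaussMap hs)]
  simp only [ENNReal.ofReal_one, one_mul] at h
  refine Eq.trans ?_ (h.trans (lintegral_congr_ae ?_))
  · rfl
  · filter_upwards [ae_gaussMeasure_mem] with x hx
    simp [gaussTransfer, (hasSum_gaussWeight hx.1.le).tsum_eq]

theorem measurable_gaussTransfer_iterate {g : ℝ → ℝ} (hg : Measurable g) (n : ℕ) :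
    Measurable (gaussTransfer^[n] g) := by
  induction n with
  | zero => exact hg
  | succ n ih => rw [Function.iterate_succ_apply']; exact measurable_gaussTransfer ih

theorem gaussTransfer_iterate_nonneg {g : ℝ → ℝ} (hg0 : ∀ x ∈ Icc (0 : ℝ) 1, 0 ≤ g x) (n : ℕ) :
    ∀ x ∈ Icc (0 : ℝ) 1, 0 ≤ gaussTransfer^[n] g x := by
  induction n with
  | zero => exact hg0
  | succ n ih =>
    rw [Function.iterate_succ_apply']
    exact fun x hx => gaussTransfer_nonneg (fun y hy => ih y (Ioc_subset_Icc_self hy)) hx.1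

theorem lintegral_mul_comp_iterate_gaussMap {g : ℝ → ℝ} (hg : Measurable g)
    (hg0 : ∀ x ∈ Icc (0 : ℝ) 1, 0 ≤ g x) (hm : MonotoneOn g (Icc 0 1))
    {H : ℝ → ENNReal} (hH : Measurable H) (n : ℕ) :
    ∫⁻ x, ENNReal.ofReal (g x) * H (gaussMap^[n] x) ∂gaussMeasure =
      ∫⁻ x, ENNReal.ofReal (gaussTransfer^[n] g x) * H x ∂gaussMeasure := by
  induction n generalizing H with
  | zero => rfl
  | succ n ih =>
    simp only [Function.iterate_succ_apply']
    rw [ih (H := fun x => H (gaussMap x)) (hH.comp measurable_gaussMap)]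
    refine lintegral_mul_comp_gaussMap (measurable_gaussTransfer_iterate hg n)
      (fun x hx => gaussTransfer_iterate_nonneg hg0 n x (Ioc_subset_Icc_self hx)) (fun x hx => ?_) hH
    refine summable_gaussWeight_mul (B := |gaussTransfer^[n] g 0| + (g 1 - g 0) * (1 / 2) ^ n)
      (fun z hz => ?_) hx.1 hx.1
    have l0 : (0 : ℝ) ∈ Icc (0 : ℝ) 1 := left_mem_Icc.2 zero_le_one
    have h1 := gaussTransfer_iterate_sub_le hm n hz l0
    have h2 := gaussTransfer_iterate_sub_le hm n l0 hz
    rw [abs_le]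
    constructor <;> linarith [neg_abs_le (gaussTransfer^[n] g 0), le_abs_self (gaussTransfer^[n] g 0)]

theorem lintegral_gaussTransfer_log_correlation (n : ℕ) {c : ℝ}
    (hc : ∫⁻ x, ENNReal.ofReal |Real.log x| ∂gaussMeasure = ENNReal.ofReal c) {K : ℝ}
    (hK : K = gaussTransfer (fun x => |Real.log x|) 1 - gaussTransfer (fun x => |Real.log x|) 0) :
    ∫⁻ x, ENNReal.ofReal |Real.log x| * ENNReal.ofReal |Real.log (gaussMap^[n + 1] x)|
      ∂gaussMeasure ≤ (ENNReal.ofReal c + ENNReal.ofReal (K * (1 / 2) ^ n)) * ENNReal.ofReal c := by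
  set g := gaussTransfer fun x => |Real.log x| with hg
  have hfm : Measurable fun x => |Real.log x| := Real.measurable_log.abs
  have hgm : Measurable g := measurable_gaussTransfer hfm
  have hg0 : ∀ x ∈ Icc (0 : ℝ) 1, 0 ≤ g x := fun x hx =>
    gaussTransfer_nonneg (fun _ _ => abs_nonneg _) hx.1
  have hmono : MonotoneOn g (Icc 0 1) := gaussTransfer_log_monotoneOn
  have key : ∀ {H : ℝ → ENNReal}, Measurable H →
      ∫⁻ x, ENNReal.ofReal |Real.log x| * H (gaussMap^[n + 1] x) ∂gaussMeasure =
        ∫⁻ x, ENNReal.ofReal (gaussTransfer^[n] g x) * H x ∂gaussMeasure := fun {H} hH => by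
    rw [← lintegral_mul_comp_iterate_gaussMap hgm hg0 hmono hH n]
    exact lintegral_mul_comp_gaussMap hfm (fun _ _ => abs_nonneg _)
      (fun x hx => summable_gaussWeight_mul_log hx hx)
      (H := fun x => H (gaussMap^[n] x)) (hH.comp (measurable_gaussMap.iterate n))
  have hmean : ∫⁻ x, ENNReal.ofReal (gaussTransfer^[n] g x) ∂gaussMeasure = ENNReal.ofReal c := by
    have := key (H := fun _ => 1) measurable_const
    simp only [mul_one] at this
    rw [← this, hc]
  have hsup : ∀ x ∈ Icc (0 : ℝ) 1, ENNReal.ofReal (gaussTransfer^[n] g x) ≤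
      ENNReal.ofReal c + ENNReal.ofReal (K * (1 / 2) ^ n) := fun x hx => by
    calc ENNReal.ofReal (gaussTransfer^[n] g x)
        = ∫⁻ _, ENNReal.ofReal (gaussTransfer^[n] g x) ∂gaussMeasure := by simp
      _ ≤ ∫⁻ y, (ENNReal.ofReal (gaussTransfer^[n] g y) + ENNReal.ofReal (K * (1 / 2) ^ n))
            ∂gaussMeasure := by
          refine lintegral_mono_ae ?_
          filter_upwards [ae_gaussMeasure_mem] with y hy
          refine le_trans (ENNReal.ofReal_le_ofReal ?_) ENNReal.ofReal_add_le
          have := gaussTransfer_iterate_sub_le hmono n hx (Ioo_subset_Icc_self hy)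
          rw [hK]
          linarith
      _ = _ := by rw [lintegral_add_right _ measurable_const, hmean]; simp
  rw [key (H := fun x => ENNReal.ofReal |Real.log x|) hfm.ennreal_ofReal]
  calc _ ≤ ∫⁻ x, (ENNReal.ofReal c + ENNReal.ofReal (K * (1 / 2) ^ n)) *
        ENNReal.ofReal |Real.log x| ∂gaussMeasure := by
        refine lintegral_mono_ae ?_
        filter_upwards [ae_gaussMeasure_mem] with x hx
        exact mul_le_mul_left (hsup x (Ioo_subset_Icc_self hx)) _
    _ = _ := by rw [lintegral_const_mul _ hfm.ennreal_ofReal, hc]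

theorem memLp_two_log : MemLp (fun x => |Real.log x|) 2 gaussMeasure := by
  have hfm : Measurable fun x => |Real.log x| := Real.measurable_log.abs
  rw [memLp_two_iff_integrable_sq hfm.aestronglyMeasurable]
  have hle : gaussMeasure ≤ ENNReal.ofReal (1 / Real.log 2) • volume.restrict (Ioo (0 : ℝ) 1) := by
    rw [← withDensity_const]
    refine withDensity_mono ?_
    filter_upwards [ae_restrict_mem measurableSet_Ioo] with x hx
    refine ENNReal.ofReal_le_ofReal ?_
    have := log_two_pos
    gcongr
    nlinarith [hx.1]
  refine Integrable.mono_measure (Integrable.smul_measure ?_ ENNReal.ofReal_ne_top) hle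
  have hr : IntegrableOn (fun x : ℝ => 16 * x ^ (-(1 / 2) : ℝ)) (Ioo 0 1) :=
    ((intervalIntegral.integrableOn_Ioo_rpow_iff one_pos).2 (by norm_num)).const_mul 16
  refine Integrable.mono' hr (hfm.pow_const 2).aestronglyMeasurable ?_
  filter_upwards [ae_restrict_mem measurableSet_Ioo] with x hx
  have h := Real.abs_log_mul_self_rpow_lt x (1 / 4) hx.1 hx.2.le (by norm_num)
  rw [Real.norm_of_nonneg (sq_nonneg _), sq_abs, Real.rpow_neg hx.1.le, ← div_eq_mul_inv,
    le_div_iff₀ (by have := hx.1; positivity)]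
  have e : x ^ (1 / 2 : ℝ) = (x ^ (1 / 4 : ℝ)) ^ 2 := by
    rw [← Real.rpow_natCast, ← Real.rpow_mul hx.1.le]
    norm_num
  rw [e, ← mul_pow, ← sq_abs]
  calc _ ≤ (4 : ℝ) ^ 2 := pow_le_pow_left₀ (abs_nonneg _) (h.le.trans (by norm_num)) 2
    _ = 16 := by norm_num

/-- The ergodic averages of `|log|` along the Gauss map converge almost everywhere. -/
theorem ae_tendsto_birkhoffSum_log :
    ∀ᵐ x ∂gaussMeasure,
      Tendsto (fun n : ℕ => birkhoffSum gaussMap (fun y => |Real.log y|) n x / n) atTop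
        (nhds (∫ x, |Real.log x| ∂gaussMeasure)) := by
  have hf := memLp_two_log
  have hfi : Integrable (fun x => |Real.log x|) gaussMeasure := hf.integrable (by norm_num)
  set c := ∫ x, |Real.log x| ∂gaussMeasure with hc
  have hc0 : 0 ≤ c := integral_nonneg fun _ => abs_nonneg _
  have hc' : ∫⁻ x, ENNReal.ofReal |Real.log x| ∂gaussMeasure = ENNReal.ofReal c :=
    (ofReal_integral_eq_lintegral_ofReal hfi (ae_of_all _ fun _ => abs_nonneg _)).symm
  obtain ⟨K, hK⟩ : ∃ K, K = gaussTransfer (fun x => |Real.log x|) 1 -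
    gaussTransfer (fun x => |Real.log x|) 0 := ⟨_, rfl⟩
  have hK0 : 0 ≤ K := by
    rw [hK]
    exact sub_nonneg.2 (gaussTransfer_log_monotoneOn (left_mem_Icc.2 zero_le_one)
      (right_mem_Icc.2 zero_le_one) zero_le_one)
  have hE0 : 0 ≤ ∫ x, |Real.log x| * |Real.log x| ∂gaussMeasure :=
    integral_nonneg fun _ => mul_self_nonneg _
  refine ae_tendsto_birkhoffSum_div measurePreserving_gaussMap (fun _ => abs_nonneg _) hf
    (D := 2 * c * K + ∫ x, |Real.log x| * |Real.log x| ∂gaussMeasure) (by positivity) fun m => ?_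
  rcases m with _ | n
  · simp only [Function.iterate_zero, id, pow_zero, mul_one]
    nlinarith [mul_nonneg hc0 hK0, sq_nonneg c]
  · have h := lintegral_gaussTransfer_log_correlation n hc' hK
    simp only [← ENNReal.ofReal_mul (abs_nonneg _)] at h
    have hint : Integrable (fun x => |Real.log x| * |Real.log (gaussMap^[n + 1] x)|) gaussMeasure :=
      hf.integrable_mul (hf.comp_measurePreserving (measurePreserving_gaussMap.iterate (n + 1)))
    rw [← ofReal_integral_eq_lintegral_ofReal hint
      (ae_of_all _ fun _ => mul_nonneg (abs_nonneg _) (abs_nonneg _)),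
      ← ENNReal.ofReal_add hc0 (by positivity), ← ENNReal.ofReal_mul (by positivity),
      ENNReal.ofReal_le_ofReal_iff (by positivity)] at h
    refine h.trans ?_
    rw [pow_succ (1 / 2 : ℝ) n]
    have : 0 ≤ (∫ x, |Real.log x| * |Real.log x| ∂gaussMeasure) * ((1 / 2) ^ n * (1 / 2)) := by
      positivity
    nlinarith

end GaussMeasure

section LogIntegral

open Set

theorem integral_pow_mul_neg_log (n : ℕ) :
    IntegrableOn (fun x : ℝ => x ^ n * -Real.log x) (Ioo 0 1) ∧
      ∫ x in Ioo (0 : ℝ) 1, x ^ n * -Real.log x = 1 / ((n : ℝ) + 1) ^ 2 := by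
  let G : ℝ → ℝ := fun x => x ^ n * (x / ((n : ℝ) + 1) ^ 2 - x * Real.log x / (n + 1))
  have hcont : ContinuousOn G (Icc 0 1) := by
    have := Real.continuous_mul_log
    exact Continuous.continuousOn (by fun_prop)
  have hderiv : ∀ x ∈ Ioo (0 : ℝ) 1, HasDerivAt G (x ^ n * -Real.log x) x := fun x hx => by
    have hx0 := hx.1.ne'
    have h := (hasDerivAt_pow n x).fun_mul (((hasDerivAt_id x).div_const (((n : ℝ) + 1) ^ 2)).fun_sub
      (((hasDerivAt_id x).fun_mul (Real.hasDerivAt_log hx0)).div_const ((n : ℝ) + 1)))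
    refine h.congr_deriv ?_
    simp only [id]
    rcases n with _ | n
    · simp [hx0]
    · have : ((n + 1 : ℕ) : ℝ) + 1 ≠ 0 := by positivity
      simp only [Nat.add_sub_cancel, pow_succ]
      field_simp
      push_cast
      ring
  have hpos : ∀ x ∈ Ioo (0 : ℝ) 1, 0 ≤ x ^ n * -Real.log x := fun x hx =>
    mul_nonneg (pow_nonneg hx.1.le n) (neg_nonneg.2 (Real.log_nonpos hx.1.le hx.2.le))
  have hint := intervalIntegral.integrableOn_deriv_of_nonneg hcont hderiv hpos
  refine ⟨hint.mono_set Ioo_subset_Ioc_self, ?_⟩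
  rw [← integral_Ioc_eq_integral_Ioo, ← intervalIntegral.integral_of_le zero_le_one,
    intervalIntegral.integral_eq_sub_of_hasDerivAt_of_le zero_le_one hcont hderiv
      ((intervalIntegrable_iff_integrableOn_Ioc_of_le zero_le_one).2 hint)]
  simp [G]

theorem hasSum_one_div_succ_sq : HasSum (fun n : ℕ => 1 / ((n : ℝ) + 1) ^ 2) (Real.pi ^ 2 / 6) := by
  simpa using (hasSum_nat_add_iff' 1).2 hasSum_zeta_two

theorem integral_neg_log_div_one_add :
    ∫ x in Ioo (0 : ℝ) 1, -Real.log x / (1 + x) = Real.pi ^ 2 / 12 := by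
  let F : ℕ → ℝ → ℝ := fun n x =>
    x ^ n * -Real.log x - 2 * (x ^ (2 * n + 1) * -Real.log x)
  have hFi : ∀ n, IntegrableOn (F n) (Ioo 0 1) := fun n =>
    (integral_pow_mul_neg_log n).1.sub ((integral_pow_mul_neg_log (2 * n + 1)).1.const_mul 2)
  have hFint : ∀ n, ∫ x in Ioo (0 : ℝ) 1, F n x = 1 / 2 * (1 / ((n : ℝ) + 1) ^ 2) := fun n => by
    simp only [F]
    rw [integral_sub (integral_pow_mul_neg_log n).1
      ((integral_pow_mul_neg_log (2 * n + 1)).1.const_mul 2), integral_const_mul,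
      (integral_pow_mul_neg_log n).2, (integral_pow_mul_neg_log (2 * n + 1)).2]
    have : (n : ℝ) + 1 ≠ 0 := by positivity
    push_cast
    rw [show (2 : ℝ) * n + 1 + 1 = 2 * (n + 1) by ring]
    field_simp
    norm_num
  have hsumm : Summable fun n : ℕ => ∫ x in Ioo (0 : ℝ) 1, ‖F n x‖ := by
    refine Summable.of_nonneg_of_le (fun n => integral_nonneg fun _ => norm_nonneg _) (fun n => ?_)
      (hasSum_one_div_succ_sq.summable.mul_left (3 / 2))
    have h1 := integral_pow_mul_neg_log n
    have h2 := integral_pow_mul_neg_log (2 * n + 1)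
    calc ∫ x in Ioo (0 : ℝ) 1, ‖F n x‖
        ≤ ∫ x in Ioo (0 : ℝ) 1,
            (x ^ n * -Real.log x + 2 * (x ^ (2 * n + 1) * -Real.log x)) := by
          refine integral_mono_ae (hFi n).norm (h1.1.add (h2.1.const_mul 2)) ?_
          filter_upwards [ae_restrict_mem measurableSet_Ioo] with x hx
          have hl : 0 ≤ -Real.log x := neg_nonneg.2 (Real.log_nonpos hx.1.le hx.2.le)
          have ha : 0 ≤ x ^ n * -Real.log x := mul_nonneg (pow_nonneg hx.1.le _) hl
          have hb : 0 ≤ x ^ (2 * n + 1) * -Real.log x := mul_nonneg (pow_nonneg hx.1.le _) hl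
          simp only [F, Real.norm_eq_abs, abs_le]
          constructor <;> linarith
      _ = 3 / 2 * (1 / ((n : ℝ) + 1) ^ 2) := by
          rw [integral_add h1.1 (h2.1.const_mul 2), integral_const_mul, h1.2, h2.2]
          have : (n : ℝ) + 1 ≠ 0 := by positivity
          push_cast
          rw [show (2 : ℝ) * n + 1 + 1 = 2 * (n + 1) by ring]
          field_simp
          norm_num
  have h := hasSum_integral_of_summable_integral_norm hFi hsumm
  simp only [hFint] at h
  have heq := h.unique (hasSum_one_div_succ_sq.mul_left (1 / 2))
  rw [show Real.pi ^ 2 / 12 = 1 / 2 * (Real.pi ^ 2 / 6) by ring, ← heq]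
  refine setIntegral_congr_fun measurableSet_Ioo fun x hx => ?_
  have hx2 : x ^ 2 < 1 := by nlinarith [hx.1, hx.2]
  have hs := ((hasSum_geometric_of_lt_one hx.1.le hx.2).mul_right (-Real.log x)).sub
    ((hasSum_geometric_of_lt_one (sq_nonneg x) hx2).mul_left (2 * x * -Real.log x))
  have hF : HasSum (fun n => F n x)
      ((1 - x)⁻¹ * -Real.log x - 2 * x * -Real.log x * (1 - x ^ 2)⁻¹) := by
    convert! hs using 2 with n
    simp only [F]
    ring
  rw [hF.tsum_eq]
  have h1 : 1 - x ≠ 0 := by linarith [hx.2]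
  have h2 : 1 + x ≠ 0 := by linarith [hx.1]
  rw [show 1 - x ^ 2 = (1 - x) * (1 + x) by ring]
  field_simp
  ring

theorem integral_abs_log_gaussMeasure :
    ∫ x, |Real.log x| ∂gaussMeasure = Real.pi ^ 2 / (12 * Real.log 2) := by
  have hl := log_two_pos
  rw [gaussMeasure, integral_withDensity_eq_integral_toReal_smul measurable_gaussDensity
    (ae_of_all _ fun _ => ENNReal.ofReal_lt_top)]
  have : ∫ x in Ioo (0 : ℝ) 1, (ENNReal.ofReal (1 / (Real.log 2 * (1 + x)))).toReal • |Real.log x| =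
      ∫ x in Ioo (0 : ℝ) 1, (Real.log 2)⁻¹ * (-Real.log x / (1 + x)) := by
    refine setIntegral_congr_fun measurableSet_Ioo fun x hx => ?_
    have hx0 := hx.1
    rw [ENNReal.toReal_ofReal (by positivity), abs_of_nonpos (Real.log_nonpos hx.1.le hx.2.le),
      smul_eq_mul]
    field_simp
  rw [this, integral_const_mul, integral_neg_log_div_one_add]
  field_simp

end LogIntegral

section Denominators

open Set

theorem qq_bounds {a : ℕ → ℤ} (ha : ∀ n, 1 ≤ a (n + 1)) (n : ℕ) :
    0 ≤ qq a n ∧ 1 ≤ qq a (n + 1) ∧ qq a n ≤ qq a (n + 1) := by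
  induction n with
  | zero => simp [qq]
  | succ n ih =>
    obtain ⟨h0, h1, h2⟩ := ih
    have e : qq a (n + 1 + 1) = a (n + 1) * qq a (n + 1) + qq a n := rfl
    have := ha n
    refine ⟨by omega, ?_, ?_⟩ <;> rw [e] <;> nlinarith

theorem digit_add_gaussMap {β : ℝ} (hβ : ∀ k, gaussMap^[k] β ∈ Ioo (0 : ℝ) 1) (n : ℕ) :
    gaussMap^[n] β * (digit β (n + 1) + gaussMap^[n + 1] β) = 1 := by
  have h0 := (hβ n).1.ne'
  rw [Function.iterate_succ_apply', gaussMap_eq_fract, digit, Nat.add_sub_cancel,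
    Int.floor_add_fract, mul_one_div_cancel h0]

theorem one_le_digit {β : ℝ} (hβ : ∀ k, gaussMap^[k] β ∈ Ioo (0 : ℝ) 1) (n : ℕ) :
    1 ≤ digit β (n + 1) := by
  rw [digit, Nat.add_sub_cancel, Int.le_floor, Int.cast_one, le_div_iff₀ (hβ n).1]
  linarith [(hβ n).2]

theorem prod_mul_qDen {β : ℝ} (hβ : ∀ k, gaussMap^[k] β ∈ Ioo (0 : ℝ) 1) (n : ℕ) :
    (∏ k ∈ Finset.range n, gaussMap^[k] β) *
      (qDen β (n + 1) + qDen β n * gaussMap^[n] β) = 1 := by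
  induction n with
  | zero => simp [qDen, qq]
  | succ n ih =>
    have e : qDen β (n + 1 + 1) = digit β (n + 1) * qDen β (n + 1) + qDen β n := rfl
    have h := digit_add_gaussMap hβ n
    rw [Finset.prod_range_succ, e]
    push_cast
    calc _ = (∏ k ∈ Finset.range n, gaussMap^[k] β) * (qDen β (n + 1) *
          (gaussMap^[n] β * (digit β (n + 1) + gaussMap^[n + 1] β)) +
            qDen β n * gaussMap^[n] β) := by ring
      _ = 1 := by rw [h, mul_one, ih]

theorem log_qDen_bounds {β : ℝ} (hβ : ∀ k, gaussMap^[k] β ∈ Ioo (0 : ℝ) 1) (n : ℕ) :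
    birkhoffSum gaussMap (fun y => |Real.log y|) n β - Real.log 2 ≤ Real.log (qDen β (n + 1)) ∧
      Real.log (qDen β (n + 1)) ≤ birkhoffSum gaussMap (fun y => |Real.log y|) n β := by
  obtain ⟨h0, h1, h2⟩ := qq_bounds (one_le_digit hβ) n
  have h0' : (0 : ℝ) ≤ qDen β n := by exact_mod_cast h0
  have h1' : (1 : ℝ) ≤ qDen β (n + 1) := by exact_mod_cast h1
  have h2' : (qDen β n : ℝ) ≤ qDen β (n + 1) := by exact_mod_cast h2
  obtain ⟨hx0, hx1⟩ := hβ n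
  have hp : 0 ≤ qDen β n * gaussMap^[n] β := by positivity
  have hS : birkhoffSum gaussMap (fun y => |Real.log y|) n β =
      Real.log (qDen β (n + 1) + qDen β n * gaussMap^[n] β) := by
    have h := congrArg Real.log (prod_mul_qDen hβ n)
    rw [Real.log_mul (Finset.prod_ne_zero_iff.2 fun k _ => (hβ k).1.ne') (by linarith),
      Real.log_prod (fun k _ => (hβ k).1.ne'), Real.log_one] at h
    have e : birkhoffSum gaussMap (fun y => |Real.log y|) n β =
        -∑ k ∈ Finset.range n, Real.log (gaussMap^[k] β) := by
      rw [birkhoffSum, ← Finset.sum_neg_distrib]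
      exact Finset.sum_congr rfl fun k _ =>
        abs_of_nonpos (Real.log_nonpos (hβ k).1.le (hβ k).2.le)
    linarith
  rw [hS]
  constructor
  · rw [sub_le_iff_le_add, ← Real.log_mul (by linarith) two_ne_zero]
    exact Real.log_le_log (by linarith) (by nlinarith)
  · exact Real.log_le_log (by linarith) (by linarith)

end Denominators

/-- (Lévy) For Lebesgue-almost every `β ∈ (0,1)`, `(1/n) log q_n(β) → π²/(12 log 2)`;
equivalently the Lyapunov exponent `λ(β) = 2 lim (1/n) log q_n(β)` equals `π²/(6 log 2)`
for almost all `β`. -/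
theorem statement6 :
    ∀ᵐ β ∂(volume.restrict (Set.Ioo (0 : ℝ) 1)),
      Tendsto (fun n : ℕ => Real.log (qDen β (n + 1)) / n) atTop
        (nhds (Real.pi ^ 2 / (12 * Real.log 2))) ∧
      Tendsto (fun n : ℕ => 2 * Real.log (qDen β (n + 1)) / n) atTop
        (nhds (Real.pi ^ 2 / (6 * Real.log 2))) := by
  refine absolutelyContinuous_gaussMeasure.ae_le ?_
  have hmem : ∀ᵐ β ∂gaussMeasure, ∀ k, gaussMap^[k] β ∈ Set.Ioo (0 : ℝ) 1 :=
    ae_all_iff.2 fun k =>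
      (measurePreserving_gaussMap.iterate k).quasiMeasurePreserving.ae ae_gaussMeasure_mem
  filter_upwards [hmem, ae_tendsto_birkhoffSum_log] with β hβ hlim
  rw [integral_abs_log_gaussMeasure] at hlim
  have hlow : Tendsto (fun n : ℕ =>
      (birkhoffSum gaussMap (fun y => |Real.log y|) n β - Real.log 2) / n) atTop
      (nhds (Real.pi ^ 2 / (12 * Real.log 2))) := by
    have := hlim.sub (tendsto_const_div_atTop_nhds_zero_nat (Real.log 2))
    simpa only [sub_zero, ← sub_div] using this
  have hq : Tendsto (fun n : ℕ => Real.log (qDen β (n + 1)) / n) atTop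
      (nhds (Real.pi ^ 2 / (12 * Real.log 2))) :=
    tendsto_of_tendsto_of_tendsto_of_le_of_le hlow hlim
      (fun n => div_le_div_of_nonneg_right (log_qDen_bounds hβ n).1 n.cast_nonneg)
      (fun n => div_le_div_of_nonneg_right (log_qDen_bounds hβ n).2 n.cast_nonneg)
  refine ⟨hq, ?_⟩
  have h2 := hq.const_mul 2
  have e : 2 * (Real.pi ^ 2 / (12 * Real.log 2)) = Real.pi ^ 2 / (6 * Real.log 2) := by
    have := log_two_pos.ne'
    field_simp
    norm_num
  rw [e] at h2
  simpa only [mul_div_assoc] using h2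
end

section
/- Let G be a subgroup of PSL₂(ℤ), let (x_k)_{k≥1} be a sequence of nonzero integers with x_k x_{k+1} < 0 for all k, and let (e_k)_{k≥1} be a sequence of elements of PSL₂(ℤ) such that e_{k+1} ∈ G · (e_k S T^{x_k}) for every k (i.e., e_{k+1} ≡_G e_k S T^{x_k} as right cosets of G). Then for every k ≥ 1, e_{k+1} ∈ G · (e₁ S T^{x₁} S T^{x₂} ⋯ S T^{x_k}); equivalently, writing ε = sign(x₁) and p_j, q_j for the convergent numerators and denominators of the digit sequence a_j = |x_j|, e_{k+1} ≡_G e₁ · ḡ_k where ḡ_k is the image in PSL₂(ℤ) of the matrix [[−ε p_{k−1}, (−1)^k p_k], [q_{k−1}, (−1)^{k+1} ε q_k]]. -/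
open Matrix MatrixGroups

/-- Convergent numerators (`pp a (k+1) = p_k`, `p_{-1}=1`, `p_0=0`). -/
def pp (a : ℕ → ℤ) : ℕ → ℤ
  | 0 => 1
  | 1 => 0
  | k + 2 => a (k + 1) * pp a (k + 1) + pp a k

/-- The image of `S = [[0,-1],[1,0]]` in `PSL₂(ℤ)`. -/
def Sbar : PSL(2, ℤ) := QuotientGroup.mk ModularGroup.S

/-- The image of `T = [[1,1],[0,1]]` in `PSL₂(ℤ)`. -/
def Tbar : PSL(2, ℤ) := QuotientGroup.mk ModularGroup.T

theorem psl_mk_neg (u : SL(2, ℤ)) :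
    (QuotientGroup.mk (-u) : PSL(2, ℤ)) = QuotientGroup.mk u := by
  rw [eq_comm, QuotientGroup.eq, mul_neg, inv_mul_cancel, Subgroup.mem_center_iff]
  simp

theorem eq_sign_mul_abs_of_alternating {x : ℕ → ℤ}
    (halt : ∀ k, 1 ≤ k → x k * x (k + 1) < 0) (k : ℕ) :
    x (k + 1) = (-1) ^ k * Int.sign (x 1) * |x (k + 1)| := by
  suffices h : Int.sign (x (k + 1)) = (-1) ^ k * Int.sign (x 1) by
    rw [← h, Int.sign_mul_abs]
  induction k with
  | zero => simp
  | succ k ih =>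
    rw [pow_succ, mul_neg_one, neg_mul, ← ih]
    rcases mul_neg_iff.mp (halt (k + 1) (by omega)) with ⟨h, h'⟩ | ⟨h, h'⟩
    · rw [Int.sign_eq_one_of_pos h, Int.sign_eq_neg_one_of_neg h']
    · rw [Int.sign_eq_neg_one_of_neg h, Int.sign_eq_one_of_pos h', neg_neg]

theorem coe_S_mul_T_zpow (n : ℤ) :
    (↑(ModularGroup.S * ModularGroup.T ^ n) : Matrix (Fin 2) (Fin 2) ℤ) = !![0, -1; 1, n] := by
  rw [Matrix.SpecialLinearGroup.coe_mul, ModularGroup.coe_S, ModularGroup.coe_T_zpow]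
  simp

/-- The product `S T^{x₁} ⋯ S T^{x_k}` is represented by the signed convergent matrix. -/
theorem exists_convergent_matrix {x : ℕ → ℤ}
    (hx : x 1 ≠ 0) (halt : ∀ k, 1 ≤ k → x k * x (k + 1) < 0) (k : ℕ) :
    ∃ u : SL(2, ℤ),
      (↑u : Matrix (Fin 2) (Fin 2) ℤ)
          = !![-(Int.sign (x 1)) * pp (fun j => |x j|) k,
                (-1) ^ k * pp (fun j => |x j|) (k + 1);
              qq (fun j => |x j|) k,
                (-1) ^ (k + 1) * Int.sign (x 1) * qq (fun j => |x j|) (k + 1)] ∧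
      (QuotientGroup.mk u : PSL(2, ℤ))
        = ((List.range k).map (fun j => Sbar * Tbar ^ (x (j + 1)))).prod := by
  have hε : Int.sign (x 1) = 1 ∨ Int.sign (x 1) = -1 := by
    rcases hx.lt_or_gt with h | h
    · exact Or.inr (Int.sign_eq_neg_one_of_neg h)
    · exact Or.inl (Int.sign_eq_one_of_pos h)
  induction k with
  | zero =>
    rcases hε with h | h
    · refine ⟨-1, ?_, by rw [psl_mk_neg]; rfl⟩
      rw [h, Matrix.SpecialLinearGroup.coe_neg, Matrix.SpecialLinearGroup.coe_one]
      ext i j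
      fin_cases i <;> fin_cases j <;> simp [pp, qq]
    · refine ⟨1, ?_, rfl⟩
      rw [h, Matrix.SpecialLinearGroup.coe_one]
      ext i j
      fin_cases i <;> fin_cases j <;> simp [pp, qq]
  | succ k ih =>
    obtain ⟨u, hu, hprod⟩ := ih
    have hmk : (QuotientGroup.mk (u * (ModularGroup.S * ModularGroup.T ^ x (k + 1))) : PSL(2, ℤ))
        = ((List.range (k + 1)).map (fun j => Sbar * Tbar ^ (x (j + 1)))).prod := by
      rw [List.range_succ, List.map_append, List.prod_append, ← hprod]
      simp [Sbar, Tbar]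
    have hcoe := Matrix.SpecialLinearGroup.coe_mul u (ModularGroup.S * ModularGroup.T ^ x (k + 1))
    rw [hu, coe_S_mul_T_zpow, eq_sign_mul_abs_of_alternating halt k] at hcoe
    rw [eq_sign_mul_abs_of_alternating halt k] at hmk
    rcases hε with h | h <;> rcases neg_one_pow_eq_or ℤ k with hk | hk <;>
      rw [h, hk] at hcoe hmk
    all_goals first
      | refine ⟨_, ?_, hmk⟩
        rw [hcoe]
        ext i j
        fin_cases i <;> fin_cases j <;> simp [pp, qq, pow_succ, h, hk] <;> ring1
      | refine ⟨_, ?_, (psl_mk_neg _).trans hmk⟩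
        rw [Matrix.SpecialLinearGroup.coe_neg, hcoe]
        ext i j
        fin_cases i <;> fin_cases j <;> simp [pp, qq, pow_succ, h, hk] <;> ring1

theorem exists_mem_mul_prod_of_step {Γ : Type*} [Group Γ] (G : Subgroup Γ) (s e : ℕ → Γ)
    (he : ∀ k, 1 ≤ k → ∃ g ∈ G, e (k + 1) = g * (e k * s k)) (k : ℕ) :
    ∃ g ∈ G, e (k + 1) = g * (e 1 * ((List.range k).map (fun j => s (j + 1))).prod) := by
  induction k with
  | zero => exact ⟨1, G.one_mem, by simp⟩
  | succ k ih =>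
    obtain ⟨g, hg, h⟩ := ih
    obtain ⟨g', hg', h'⟩ := he (k + 1) (by omega)
    refine ⟨g' * g, G.mul_mem hg' hg, ?_⟩
    rw [h', h, List.range_succ, List.map_append, List.prod_append]
    simp [mul_assoc]

/-- Let `G ≤ PSL₂(ℤ)`, let `(x_k)_{k≥1}` be nonzero integers with `x_k x_{k+1} < 0`, and
let `(e_k)` in `PSL₂(ℤ)` satisfy `e_{k+1} ∈ G·(e_k S T^{x_k})` for all `k`.  Then for all
`k ≥ 1`, `e_{k+1} ∈ G·(e₁ S T^{x₁} ⋯ S T^{x_k})`; equivalently, with `ε = sign x₁` and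
`p_j, q_j` the convergents of the digits `a_j = |x_j|`, `e_{k+1} ≡_G e₁·ḡ_k` where `ḡ_k`
is the image in `PSL₂(ℤ)` of `[[-ε p_{k-1}, (-1)^k p_k], [q_{k-1}, (-1)^{k+1} ε q_k]]`. -/
theorem statement12 (G : Subgroup PSL(2, ℤ)) (x : ℕ → ℤ) (e : ℕ → PSL(2, ℤ))
    (hx : ∀ k, 1 ≤ k → x k ≠ 0) (halt : ∀ k, 1 ≤ k → x k * x (k + 1) < 0)
    (he : ∀ k, 1 ≤ k → ∃ g ∈ G, e (k + 1) = g * (e k * (Sbar * Tbar ^ (x k))))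
    (k : ℕ) (hk : 1 ≤ k) :
    (∃ g ∈ G, e (k + 1)
        = g * (e 1 * ((List.range k).map (fun j => Sbar * Tbar ^ (x (j + 1)))).prod)) ∧
    (∃ g ∈ G, ∃ u : SL(2, ℤ),
      (↑u : Matrix (Fin 2) (Fin 2) ℤ)
          = !![-(Int.sign (x 1)) * pp (fun j => |x j|) k,
                (-1) ^ k * pp (fun j => |x j|) (k + 1);
              qq (fun j => |x j|) k,
                (-1) ^ (k + 1) * Int.sign (x 1) * qq (fun j => |x j|) (k + 1)] ∧
      e (k + 1) = g * (e 1 * QuotientGroup.mk u)) := by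
  obtain ⟨g, hg, h⟩ :=
    exists_mem_mul_prod_of_step G (fun j => Sbar * Tbar ^ (x j)) e he k
  obtain ⟨u, hu, hprod⟩ := exists_convergent_matrix (hx 1 le_rfl) halt k
  exact ⟨⟨g, hg, h⟩, g, hg, u, hu, by rw [hprod]; exact h⟩
end
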